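/- arXiv:1011.2027 — 11 statements merged into one kernel-verified Lean document; each statement's English description precedes it below -/
import Mathlib

section
/- (Generalized Banachiewicz formula.) Let M : E ⊕ F → G ⊕ H be the block linear map with blocks A : E → G, B : F → G, C : E → H, D : F → H, and suppose range(B) ⊆ range(A) and ker(A) ⊆ ker(C). Let A⁻ be a generalized inverse of A, set X = D − C ∘ A⁻ ∘ B, and let X⁻ be a generalized inverse of X. Then the block linear map N : G ⊕ H → E ⊕ F with blocks [[A⁻ + A⁻BX⁻CA⁻, −A⁻BX⁻],[−X⁻CA⁻, X⁻]] is a generalized inverse of M, i.e. M ∘ N ∘ M = M. -/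
/-- The 2×2 block linear map `[[A, B], [C, D]] : E × F →ₗ G × H`,
`(x, y) ↦ (A x + B y, C x + D y)`. -/
def blockMap {𝕜 E F G H : Type*} [Field 𝕜]
    [AddCommGroup E] [Module 𝕜 E] [AddCommGroup F] [Module 𝕜 F]
    [AddCommGroup G] [Module 𝕜 G] [AddCommGroup H] [Module 𝕜 H]
    (A : E →ₗ[𝕜] G) (B : F →ₗ[𝕜] G) (C : E →ₗ[𝕜] H) (D : F →ₗ[𝕜] H) :
    (E × F) →ₗ[𝕜] (G × H) :=
  LinearMap.prod (A.coprod B) (C.coprod D)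

/-- **generalized Banachiewicz formula.** If `range B ⊆ range A`,
`ker A ⊆ ker C`, `A⁻` is a generalized inverse of `A`, `X = D − C A⁻ B`, and `X⁻`
is a generalized inverse of `X`, then the block map
`[[A⁻ + A⁻BX⁻CA⁻, −A⁻BX⁻], [−X⁻CA⁻, X⁻]]` is a generalized inverse of the block
map `M = [[A, B], [C, D]]`. -/
theorem genBanachiewicz
    {𝕜 E F G H : Type*} [Field 𝕜]
    [AddCommGroup E] [Module 𝕜 E] [AddCommGroup F] [Module 𝕜 F]
    [AddCommGroup G] [Module 𝕜 G] [AddCommGroup H] [Module 𝕜 H]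
    (A : E →ₗ[𝕜] G) (B : F →ₗ[𝕜] G) (C : E →ₗ[𝕜] H) (D : F →ₗ[𝕜] H)
    (hranB : LinearMap.range B ≤ LinearMap.range A)
    (hkerA : LinearMap.ker A ≤ LinearMap.ker C)
    (Ainv : G →ₗ[𝕜] E) (hA : A ∘ₗ Ainv ∘ₗ A = A)
    (Xinv : H →ₗ[𝕜] F)
    (hX : (D - C ∘ₗ Ainv ∘ₗ B) ∘ₗ Xinv ∘ₗ (D - C ∘ₗ Ainv ∘ₗ B)
            = D - C ∘ₗ Ainv ∘ₗ B) :
    blockMap A B C D ∘ₗ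
        blockMap (Ainv + Ainv ∘ₗ B ∘ₗ Xinv ∘ₗ C ∘ₗ Ainv) (-(Ainv ∘ₗ B ∘ₗ Xinv))
          (-(Xinv ∘ₗ C ∘ₗ Ainv)) Xinv ∘ₗ
        blockMap A B C D
      = blockMap A B C D := by
  have hAB (y : F) : A (Ainv (B y)) = B y := by
    obtain ⟨x, hx⟩ := hranB (LinearMap.mem_range_self B y)
    rw [← hx]
    exact LinearMap.congr_fun hA x
  have hAA (x : E) : A (Ainv (A x)) = A x := LinearMap.congr_fun hA x
  have hCA (x : E) : C (Ainv (A x)) = C x := by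
    have h : Ainv (A x) - x ∈ LinearMap.ker C :=
      hkerA (by rw [LinearMap.mem_ker, map_sub, hAA, sub_self])
    rwa [LinearMap.mem_ker, map_sub, sub_eq_zero] at h
  refine LinearMap.ext fun ⟨x, y⟩ => ?_
  obtain ⟨w, hw⟩ : ∃ w, w = Xinv (D y - C (Ainv (B y))) := ⟨_, rfl⟩
  have hXw : D w - C (Ainv (B w)) = D y - C (Ainv (B y)) := by
    rw [hw]
    exact LinearMap.congr_fun hX y
  have hN : blockMap (Ainv + Ainv ∘ₗ B ∘ₗ Xinv ∘ₗ C ∘ₗ Ainv) (-(Ainv ∘ₗ B ∘ₗ Xinv))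
      (-(Xinv ∘ₗ C ∘ₗ Ainv)) Xinv (blockMap A B C D (x, y))
      = (Ainv (A x) + Ainv (B y) - Ainv (B w), w) := by
    rw [hw]
    ext <;> simp [blockMap, hCA] <;> abel
  rw [LinearMap.comp_apply, LinearMap.comp_apply, hN]
  ext
  · simp [blockMap, hAA, hAB]
  · simp only [blockMap, LinearMap.prod_apply, Function.prod_apply, LinearMap.coprod_apply,
      map_add, map_sub, hCA]
    rw [sub_add_eq_add_sub, add_sub_assoc, hXw]
    abel_nf
end

section
/- (Successive complementation rule, first form.) Assume conditions (1)–(6) hold. Let P⁻ be any generalized inverse of P, M₃₃⁻ any generalized inverse of M₃₃, and Ξ⁻ any generalized inverse of Ξ := M₂₂ − M₂₃ M₃₃⁻ M₃₂. Then M₁₁ − [M₁₂ M₁₃] ∘ P⁻ ∘ [M₂₁; M₃₁] = (M₁₁ − M₁₃ M₃₃⁻ M₃₁) − (M₁₂ − M₁₃ M₃₃⁻ M₃₂) ∘ Ξ⁻ ∘ (M₂₁ − M₂₃ M₃₃⁻ M₃₁). -/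
/-- If `G` is a generalized inverse of `A` and `ker A ≤ ker C`, then `C G A = C`. -/
theorem LinearMap.apply_generalizedInverse_apply_of_ker_le
    {R U V W : Type*} [Ring R] [AddCommGroup U] [Module R U] [AddCommGroup V] [Module R V]
    [AddCommGroup W] [Module R W] {A : U →ₗ[R] V} {G : V →ₗ[R] U} {C : U →ₗ[R] W}
    (hA : A ∘ₗ G ∘ₗ A = A) (hC : LinearMap.ker A ≤ LinearMap.ker C) (x : U) :
    C (G (A x)) = C x := by
  have h : G (A x) - x ∈ LinearMap.ker A := by
    rw [LinearMap.mem_ker, map_sub, sub_eq_zero]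
    exact LinearMap.congr_fun hA x
  exact sub_eq_zero.mp (by simpa using hC h)

/-- **successive complementation rule, first form.**
With `P = [[M₂₂, M₂₃], [M₃₂, M₃₃]]`, conditions (1)–(6), `P⁻` a generalized
inverse of `P`, `M₃₃⁻` a generalized inverse of `M₃₃`, and `Ξ⁻` a generalized
inverse of `Ξ = M₂₂ − M₂₃ M₃₃⁻ M₃₂`, one has
`M₁₁ − [M₁₂ M₁₃] P⁻ [M₂₁; M₃₁]
  = (M₁₁ − M₁₃ M₃₃⁻ M₃₁) − (M₁₂ − M₁₃ M₃₃⁻ M₃₂) Ξ⁻ (M₂₁ − M₂₃ M₃₃⁻ M₃₁)`. -/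
theorem successive_schur_complement_first_form
    {𝕜 V₁ V₂ V₃ : Type*} [Field 𝕜]
    [AddCommGroup V₁] [Module 𝕜 V₁] [AddCommGroup V₂] [Module 𝕜 V₂]
    [AddCommGroup V₃] [Module 𝕜 V₃]
    (M11 : V₁ →ₗ[𝕜] V₁) (M12 : V₂ →ₗ[𝕜] V₁) (M13 : V₃ →ₗ[𝕜] V₁)
    (M21 : V₁ →ₗ[𝕜] V₂) (M22 : V₂ →ₗ[𝕜] V₂) (M23 : V₃ →ₗ[𝕜] V₂)
    (M31 : V₁ →ₗ[𝕜] V₃) (M32 : V₂ →ₗ[𝕜] V₃) (M33 : V₃ →ₗ[𝕜] V₃)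
    -- conditions (1)–(6)
    (h1 : LinearMap.ker (LinearMap.prod (M22.coprod M23) (M32.coprod M33))
            ≤ LinearMap.ker (M12.coprod M13))
    (h2 : LinearMap.range (M21.prod M31)
            ≤ LinearMap.range (LinearMap.prod (M22.coprod M23) (M32.coprod M33)))
    (h3 : LinearMap.ker M33 ≤ LinearMap.ker M23)
    (h4 : LinearMap.range M32 ≤ LinearMap.range M33)
    (h5 : LinearMap.ker M22 ≤ LinearMap.ker M32)
    (h6 : LinearMap.range M23 ≤ LinearMap.range M22)
    -- generalized inverses
    (Pinv : (V₂ × V₃) →ₗ[𝕜] (V₂ × V₃))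
    (hP : LinearMap.prod (M22.coprod M23) (M32.coprod M33) ∘ₗ Pinv ∘ₗ
            LinearMap.prod (M22.coprod M23) (M32.coprod M33)
          = LinearMap.prod (M22.coprod M23) (M32.coprod M33))
    (M33inv : V₃ →ₗ[𝕜] V₃) (h33 : M33 ∘ₗ M33inv ∘ₗ M33 = M33)
    (Xiinv : V₂ →ₗ[𝕜] V₂)
    (hXi : (M22 - M23 ∘ₗ M33inv ∘ₗ M32) ∘ₗ Xiinv ∘ₗ (M22 - M23 ∘ₗ M33inv ∘ₗ M32)
            = M22 - M23 ∘ₗ M33inv ∘ₗ M32) :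
    M11 - (M12.coprod M13) ∘ₗ Pinv ∘ₗ (M21.prod M31)
      = (M11 - M13 ∘ₗ M33inv ∘ₗ M31)
        - (M12 - M13 ∘ₗ M33inv ∘ₗ M32) ∘ₗ Xiinv ∘ₗ (M21 - M23 ∘ₗ M33inv ∘ₗ M31) := by
  have h13 : LinearMap.ker M33 ≤ LinearMap.ker M13 := fun z hz => by
    have hz' : M33 z = 0 := hz
    have hz'' : M23 z = 0 := h3 hz
    have h : ((0 : V₂), z) ∈ LinearMap.ker (M12.coprod M13) := h1 (by simp [hz', hz''])
    simpa using h
  have h32 (u : V₂) : M33 (M33inv (M32 u)) = M32 u := by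
    obtain ⟨v, hv⟩ := h4 ⟨u, rfl⟩
    rw [← hv]
    exact LinearMap.congr_fun h33 v
  have hker : LinearMap.ker (M22 - M23 ∘ₗ M33inv ∘ₗ M32)
      ≤ LinearMap.ker (M12 - M13 ∘ₗ M33inv ∘ₗ M32) := fun u hu => by
    have hu' : M22 u - M23 (M33inv (M32 u)) = 0 := hu
    have h : (u, -M33inv (M32 u)) ∈ LinearMap.ker (M12.coprod M13) :=
      h1 (by simp [h32, ← sub_eq_add_neg, hu'])
    simpa [← sub_eq_add_neg] using h
  ext x
  obtain ⟨⟨y, z⟩, hyz⟩ := h2 ⟨x, rfl⟩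
  have h21 : M21 x = M22 y + M23 z := (congrArg Prod.fst hyz).symm
  have h31 : M31 x = M32 y + M33 z := (congrArg Prod.snd hyz).symm
  have hXi_apply : (M21 - M23 ∘ₗ M33inv ∘ₗ M31) x = (M22 - M23 ∘ₗ M33inv ∘ₗ M32) y := by
    have h := LinearMap.apply_generalizedInverse_apply_of_ker_le h33 h3 z
    simp only [LinearMap.sub_apply, LinearMap.comp_apply, h21, h31, map_add, h]
    abel
  rw [LinearMap.sub_apply, LinearMap.sub_apply, LinearMap.comp_apply, LinearMap.comp_apply,
    LinearMap.comp_apply, LinearMap.comp_apply, ← hyz, hXi_apply,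
    LinearMap.apply_generalizedInverse_apply_of_ker_le hP h1,
    LinearMap.apply_generalizedInverse_apply_of_ker_le hXi hker]
  have h := LinearMap.apply_generalizedInverse_apply_of_ker_le h33 h13 z
  simp only [LinearMap.sub_apply, LinearMap.comp_apply, LinearMap.coprod_apply, h31, map_add, h]
  abel
end

section
/- (Successive complementation rule, second form.) Assume conditions (1)–(6) hold. Let P⁻ be any generalized inverse of P, M₂₂⁻ any generalized inverse of M₂₂, and Θ⁻ any generalized inverse of Θ := M₃₃ − M₃₂ M₂₂⁻ M₂₃. Then M₁₁ − [M₁₂ M₁₃] ∘ P⁻ ∘ [M₂₁; M₃₁] = (M₁₁ − M₁₂ M₂₂⁻ M₂₁) − (M₁₃ − M₁₂ M₂₂⁻ M₂₃) ∘ Θ⁻ ∘ (M₃₁ − M₃₂ M₂₂⁻ M₂₁). -/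
/-- If `g` is a generalized inverse of `f` and `ker f ≤ ker h`, then `h ∘ g ∘ f = h`. -/
theorem LinearMap.apply_genInverse_apply_of_ker_le_ker {R E F G : Type*} [Ring R]
    [AddCommGroup E] [Module R E] [AddCommGroup F] [Module R F] [AddCommGroup G] [Module R G]
    {f : E →ₗ[R] F} {g : F →ₗ[R] E} {h : E →ₗ[R] G}
    (hg : f ∘ₗ g ∘ₗ f = f) (hker : LinearMap.ker f ≤ LinearMap.ker h) (x : E) :
    h (g (f x)) = h x := by
  have hx : g (f x) - x ∈ LinearMap.ker f := by
    simpa [sub_eq_zero] using LinearMap.congr_fun hg x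
  simpa [sub_eq_zero] using hker hx

/-- If `g` is a generalized inverse of `f`, then `f ∘ g` fixes the range of `f`. -/
theorem LinearMap.apply_genInverse_of_mem_range {R E F : Type*} [Semiring R]
    [AddCommMonoid E] [Module R E] [AddCommMonoid F] [Module R F]
    {f : E →ₗ[R] F} {g : F →ₗ[R] E} (hg : f ∘ₗ g ∘ₗ f = f) {y : F}
    (hy : y ∈ LinearMap.range f) : f (g y) = y := by
  obtain ⟨x, rfl⟩ := hy
  exact LinearMap.congr_fun hg x

/-- **successive complementation rule, second form.**
With `P = [[M₂₂, M₂₃], [M₃₂, M₃₃]]`, conditions (1)–(6), `P⁻` a generalized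
inverse of `P`, `M₂₂⁻` a generalized inverse of `M₂₂`, and `Θ⁻` a generalized
inverse of `Θ = M₃₃ − M₃₂ M₂₂⁻ M₂₃`, one has
`M₁₁ − [M₁₂ M₁₃] P⁻ [M₂₁; M₃₁]
  = (M₁₁ − M₁₂ M₂₂⁻ M₂₁) − (M₁₃ − M₁₂ M₂₂⁻ M₂₃) Θ⁻ (M₃₁ − M₃₂ M₂₂⁻ M₂₁)`. -/
theorem successive_schur_complement_second_form
    {𝕜 V₁ V₂ V₃ : Type*} [Field 𝕜]
    [AddCommGroup V₁] [Module 𝕜 V₁] [AddCommGroup V₂] [Module 𝕜 V₂]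
    [AddCommGroup V₃] [Module 𝕜 V₃]
    (M11 : V₁ →ₗ[𝕜] V₁) (M12 : V₂ →ₗ[𝕜] V₁) (M13 : V₃ →ₗ[𝕜] V₁)
    (M21 : V₁ →ₗ[𝕜] V₂) (M22 : V₂ →ₗ[𝕜] V₂) (M23 : V₃ →ₗ[𝕜] V₂)
    (M31 : V₁ →ₗ[𝕜] V₃) (M32 : V₂ →ₗ[𝕜] V₃) (M33 : V₃ →ₗ[𝕜] V₃)
    -- conditions (1)–(6)
    (h1 : LinearMap.ker (LinearMap.prod (M22.coprod M23) (M32.coprod M33))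
            ≤ LinearMap.ker (M12.coprod M13))
    (h2 : LinearMap.range (M21.prod M31)
            ≤ LinearMap.range (LinearMap.prod (M22.coprod M23) (M32.coprod M33)))
    (h3 : LinearMap.ker M33 ≤ LinearMap.ker M23)
    (h4 : LinearMap.range M32 ≤ LinearMap.range M33)
    (h5 : LinearMap.ker M22 ≤ LinearMap.ker M32)
    (h6 : LinearMap.range M23 ≤ LinearMap.range M22)
    -- generalized inverses
    (Pinv : (V₂ × V₃) →ₗ[𝕜] (V₂ × V₃))
    (hP : LinearMap.prod (M22.coprod M23) (M32.coprod M33) ∘ₗ Pinv ∘ₗ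
            LinearMap.prod (M22.coprod M23) (M32.coprod M33)
          = LinearMap.prod (M22.coprod M23) (M32.coprod M33))
    (M22inv : V₂ →ₗ[𝕜] V₂) (h22 : M22 ∘ₗ M22inv ∘ₗ M22 = M22)
    (Thetainv : V₃ →ₗ[𝕜] V₃)
    (hTheta : (M33 - M32 ∘ₗ M22inv ∘ₗ M23) ∘ₗ Thetainv ∘ₗ (M33 - M32 ∘ₗ M22inv ∘ₗ M23)
            = M33 - M32 ∘ₗ M22inv ∘ₗ M23) :
    M11 - (M12.coprod M13) ∘ₗ Pinv ∘ₗ (M21.prod M31)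
      = (M11 - M12 ∘ₗ M22inv ∘ₗ M21)
        - (M13 - M12 ∘ₗ M22inv ∘ₗ M23) ∘ₗ Thetainv ∘ₗ (M31 - M32 ∘ₗ M22inv ∘ₗ M21) := by
  have ker_M22 : LinearMap.ker M22 ≤ LinearMap.ker M12 := fun x hx => by
    have hx' : ((x, 0) : V₂ × V₃) ∈
        LinearMap.ker (LinearMap.prod (M22.coprod M23) (M32.coprod M33)) := by
      simpa using And.intro hx (h5 hx)
    simpa using h1 hx'
  have ker_Theta : LinearMap.ker (M33 - M32 ∘ₗ M22inv ∘ₗ M23) ≤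
      LinearMap.ker (M13 - M12 ∘ₗ M22inv ∘ₗ M23) := fun x hx => by
    have hM23 : M22 (M22inv (M23 x)) = M23 x :=
      LinearMap.apply_genInverse_of_mem_range h22 (h6 ⟨x, rfl⟩)
    have hx' : ((-M22inv (M23 x), x) : V₂ × V₃) ∈
        LinearMap.ker (LinearMap.prod (M22.coprod M23) (M32.coprod M33)) := by
      simpa [hM23, neg_add_eq_sub] using hx
    simpa [neg_add_eq_sub] using h1 hx'
  ext v
  obtain ⟨⟨a, b⟩, hab⟩ := h2 ⟨v, rfl⟩
  obtain ⟨hM21, hM31⟩ : M22 a + M23 b = M21 v ∧ M32 a + M33 b = M31 v := by simpa using hab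
  have hrow : (M12.coprod M13) (Pinv (M21.prod M31 v)) = M12 a + M13 b := by
    rw [← hab, LinearMap.apply_genInverse_apply_of_ker_le_ker hP h1, LinearMap.coprod_apply]
  have hM12 : M12 (M22inv (M22 a)) = M12 a :=
    LinearMap.apply_genInverse_apply_of_ker_le_ker h22 ker_M22 a
  have hM32 : M32 (M22inv (M22 a)) = M32 a :=
    LinearMap.apply_genInverse_apply_of_ker_le_ker h22 h5 a
  have hcol : (M31 - M32 ∘ₗ M22inv ∘ₗ M21) v = (M33 - M32 ∘ₗ M22inv ∘ₗ M23) b := by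
    simp only [LinearMap.sub_apply, LinearMap.comp_apply, ← hM21, ← hM31, map_add, hM32]
    abel
  rw [LinearMap.sub_apply, LinearMap.comp_apply, LinearMap.comp_apply, hrow,
    LinearMap.sub_apply (M11 - _), LinearMap.comp_apply (M13 - _), LinearMap.comp_apply Thetainv,
    hcol, LinearMap.apply_genInverse_apply_of_ker_le_ker hTheta ker_Theta]
  simp only [LinearMap.sub_apply, LinearMap.comp_apply, ← hM21, map_add, hM12]
  abel
end

section
/- Assume conditions (1)–(6) hold. Then the following kernel and image inclusions hold: ker M₂₂ ⊆ ker M₁₂, range M₂₁ ⊆ range M₂₂, ker M₃₃ ⊆ ker M₁₃, and range M₃₁ ⊆ range M₃₃. -/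
/-- Under conditions (1)–(6) the following inclusions hold:
`ker M₂₂ ⊆ ker M₁₂`, `range M₂₁ ⊆ range M₂₂`, `ker M₃₃ ⊆ ker M₁₃`,
and `range M₃₁ ⊆ range M₃₃`. -/
theorem schur_kernel_image_inclusions
    {𝕜 V₁ V₂ V₃ : Type*} [Field 𝕜]
    [AddCommGroup V₁] [Module 𝕜 V₁] [AddCommGroup V₂] [Module 𝕜 V₂]
    [AddCommGroup V₃] [Module 𝕜 V₃]
    (M12 : V₂ →ₗ[𝕜] V₁) (M13 : V₃ →ₗ[𝕜] V₁)
    (M21 : V₁ →ₗ[𝕜] V₂) (M22 : V₂ →ₗ[𝕜] V₂) (M23 : V₃ →ₗ[𝕜] V₂)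
    (M31 : V₁ →ₗ[𝕜] V₃) (M32 : V₂ →ₗ[𝕜] V₃) (M33 : V₃ →ₗ[𝕜] V₃)
    -- conditions (1)–(6)
    (h1 : LinearMap.ker (LinearMap.prod (M22.coprod M23) (M32.coprod M33))
            ≤ LinearMap.ker (M12.coprod M13))
    (h2 : LinearMap.range (M21.prod M31)
            ≤ LinearMap.range (LinearMap.prod (M22.coprod M23) (M32.coprod M33)))
    (h3 : LinearMap.ker M33 ≤ LinearMap.ker M23)
    (h4 : LinearMap.range M32 ≤ LinearMap.range M33)
    (h5 : LinearMap.ker M22 ≤ LinearMap.ker M32)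
    (h6 : LinearMap.range M23 ≤ LinearMap.range M22) :
    LinearMap.ker M22 ≤ LinearMap.ker M12 ∧
    LinearMap.range M21 ≤ LinearMap.range M22 ∧
    LinearMap.ker M33 ≤ LinearMap.ker M13 ∧
    LinearMap.range M31 ≤ LinearMap.range M33 := by
  have hblock (x : V₁) : ∃ a b, M22 a + M23 b = M21 x ∧ M32 a + M33 b = M31 x := by
    obtain ⟨⟨a, b⟩, hab⟩ := h2 ⟨x, rfl⟩
    exact ⟨a, b, congrArg Prod.fst hab, congrArg Prod.snd hab⟩
  refine ⟨fun v hv => ?_, ?_, fun v hv => ?_, ?_⟩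
  · have h32 := h5 hv
    have h := @h1 (v, 0)
    simp_all
  · rintro _ ⟨x, rfl⟩
    obtain ⟨a, b, hab, -⟩ := hblock x
    exact hab ▸ add_mem ⟨a, rfl⟩ (h6 ⟨b, rfl⟩)
  · have h23 := h3 hv
    have h := @h1 (0, v)
    simp_all
  · rintro _ ⟨x, rfl⟩
    obtain ⟨a, b, -, hab⟩ := hblock x
    exact hab ▸ add_mem (h4 ⟨a, rfl⟩) ⟨b, rfl⟩
end

section
/- Assume conditions (1)–(6) hold and let M₃₃⁻ be any generalized inverse of M₃₃. Then the second-step generalized Schur complement is well-defined: range(M₂₁ − M₂₃ M₃₃⁻ M₃₁) ⊆ range(M₂₂ − M₂₃ M₃₃⁻ M₃₂) and ker(M₂₂ − M₂₃ M₃₃⁻ M₃₂) ⊆ ker(M₁₂ − M₁₃ M₃₃⁻ M₃₂). -/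
/-- Under conditions (1)–(6), for any generalized inverse
`M₃₃⁻` of `M₃₃` the second-step generalized Schur complement is well-defined:
`range (M₂₁ − M₂₃ M₃₃⁻ M₃₁) ⊆ range (M₂₂ − M₂₃ M₃₃⁻ M₃₂)` and
`ker (M₂₂ − M₂₃ M₃₃⁻ M₃₂) ⊆ ker (M₁₂ − M₁₃ M₃₃⁻ M₃₂)`. -/
theorem second_step_schur_well_defined
    {𝕜 V₁ V₂ V₃ : Type*} [Field 𝕜]
    [AddCommGroup V₁] [Module 𝕜 V₁] [AddCommGroup V₂] [Module 𝕜 V₂]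
    [AddCommGroup V₃] [Module 𝕜 V₃]
    (M12 : V₂ →ₗ[𝕜] V₁) (M13 : V₃ →ₗ[𝕜] V₁)
    (M21 : V₁ →ₗ[𝕜] V₂) (M22 : V₂ →ₗ[𝕜] V₂) (M23 : V₃ →ₗ[𝕜] V₂)
    (M31 : V₁ →ₗ[𝕜] V₃) (M32 : V₂ →ₗ[𝕜] V₃) (M33 : V₃ →ₗ[𝕜] V₃)
    -- conditions (1)–(6)
    (h1 : LinearMap.ker (LinearMap.prod (M22.coprod M23) (M32.coprod M33))
            ≤ LinearMap.ker (M12.coprod M13))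
    (h2 : LinearMap.range (M21.prod M31)
            ≤ LinearMap.range (LinearMap.prod (M22.coprod M23) (M32.coprod M33)))
    (h3 : LinearMap.ker M33 ≤ LinearMap.ker M23)
    (h4 : LinearMap.range M32 ≤ LinearMap.range M33)
    (h5 : LinearMap.ker M22 ≤ LinearMap.ker M32)
    (h6 : LinearMap.range M23 ≤ LinearMap.range M22)
    (M33inv : V₃ →ₗ[𝕜] V₃) (h33 : M33 ∘ₗ M33inv ∘ₗ M33 = M33) :
    LinearMap.range (M21 - M23 ∘ₗ M33inv ∘ₗ M31)
        ≤ LinearMap.range (M22 - M23 ∘ₗ M33inv ∘ₗ M32) ∧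
    LinearMap.ker (M22 - M23 ∘ₗ M33inv ∘ₗ M32)
        ≤ LinearMap.ker (M12 - M13 ∘ₗ M33inv ∘ₗ M32) := by
  have hinv (y : V₃) : M33 (M33inv (M33 y)) = M33 y := LinearMap.congr_fun h33 y
  refine ⟨?_, fun v hv => ?_⟩
  · rintro _ ⟨v, rfl⟩
    obtain ⟨⟨x, y⟩, hxy⟩ := h2 ⟨v, rfl⟩
    simp only [LinearMap.prod_apply, Function.prod_apply, LinearMap.coprod_apply,
      Prod.mk.injEq] at hxy
    obtain ⟨h21, h31⟩ := hxy
    have h23 : M23 (M33inv (M33 y)) = M23 y := by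
      have : M33inv (M33 y) - y ∈ LinearMap.ker M23 := h3 (by simp [hinv])
      simpa [sub_eq_zero] using this
    refine ⟨x, ?_⟩
    simp only [LinearMap.sub_apply, LinearMap.comp_apply, ← h21, ← h31, map_add, h23]
    abel
  · obtain ⟨w, hw⟩ := h4 ⟨v, rfl⟩
    have hw' : M33 (M33inv (M32 v)) = M32 v := by rw [← hw, hinv]
    have hv' : M22 v - M23 (M33inv (M32 v)) = 0 := hv
    have hker : (v, -M33inv (M32 v)) ∈ LinearMap.ker (M12.coprod M13) := h1 (by
      simp [← sub_eq_add_neg, hv', hw'])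
    simpa [← sub_eq_add_neg] using hker
end

section
/- Let H and K be complex Hilbert spaces, A : H → H a bounded operator with bounded inverse, C : H → K a bounded operator, and S : K → K a unitary operator, satisfying A + A* = −C*C. Then the operator Ŝ := (I + C A⁻¹ C*) S on K is unitary. -/
open ContinuousLinearMap

/-- If `B + B' + B (C*C) B' = 0`, then `(1 + C B C*) (1 + C B' C*) = 1`. -/
theorem one_add_conj_comp_one_add_conj {H K : Type*}
    [NormedAddCommGroup H] [InnerProductSpace ℂ H] [CompleteSpace H]
    [NormedAddCommGroup K] [InnerProductSpace ℂ K] [CompleteSpace K]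
    (B B' : H →L[ℂ] H) (C : H →L[ℂ] K)
    (h : B + B' + B ∘L (adjoint C ∘L C) ∘L B' = 0) :
    (1 + C ∘L B ∘L adjoint C) ∘L (1 + C ∘L B' ∘L adjoint C) = 1 := by
  ext x
  have hx := congrArg C (DFunLike.congr_fun h (adjoint C x))
  simp only [add_apply, comp_apply, zero_apply, map_add, map_zero, one_apply_eq_self] at hx ⊢
  calc _ = x + (C (B (adjoint C x)) + C (B' (adjoint C x))
        + C (B (adjoint C (C (B' (adjoint C x)))))) := by abel
    _ = x := by rw [hx, add_zero]

/-- If `B A = 1`, `A' B' = 1` and `A + A' = -D`, then `B + B' + B D B' = 0`. -/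
theorem add_add_mul_mul_eq_zero {R : Type*} [Ring R] {A A' B B' D : R}
    (hBA : B * A = 1) (hAB' : A' * B' = 1) (hD : A + A' = -D) :
    B + B' + B * (D * B') = 0 := by
  rw [eq_neg_of_add_eq_zero_left (a := D) (b := A + A') (by rw [hD, add_neg_cancel])]
  have h₁ : B * (A * B') = B' := by rw [← mul_assoc, hBA, one_mul]
  rw [neg_mul, mul_neg, add_mul, mul_add, h₁, hAB', mul_one]
  abel

/-- If `A` is invertible, `S` is unitary and
`A + A* = −C*C`, then `Ŝ = (I + C A⁻¹ C*) S` is unitary. -/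
theorem hatS_unitary {H K : Type*}
    [NormedAddCommGroup H] [InnerProductSpace ℂ H] [CompleteSpace H]
    [NormedAddCommGroup K] [InnerProductSpace ℂ K] [CompleteSpace K]
    (A Ainv : H →L[ℂ] H) (hA₁ : A ∘L Ainv = 1) (hA₂ : Ainv ∘L A = 1)
    (C : H →L[ℂ] K) (S : K →L[ℂ] K)
    (hS₁ : adjoint S ∘L S = 1) (hS₂ : S ∘L adjoint S = 1)
    (hACC : A + adjoint A = -(adjoint C ∘L C)) :
    adjoint ((1 + C ∘L Ainv ∘L adjoint C) ∘L S) ∘L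
        ((1 + C ∘L Ainv ∘L adjoint C) ∘L S) = 1 ∧
    ((1 + C ∘L Ainv ∘L adjoint C) ∘L S) ∘L
        adjoint ((1 + C ∘L Ainv ∘L adjoint C) ∘L S) = 1 := by
  have hB₁ : adjoint Ainv ∘L adjoint A = 1 := by
    rw [← adjoint_comp, hA₁]; exact star_one _
  have hB₂ : adjoint A ∘L adjoint Ainv = 1 := by
    rw [← adjoint_comp, hA₂]; exact star_one _
  have hadj : adjoint (1 + C ∘L Ainv ∘L adjoint C) = 1 + C ∘L adjoint Ainv ∘L adjoint C := by
    have h1 : adjoint (1 : K →L[ℂ] K) = 1 := star_one _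
    rw [map_add, h1, adjoint_comp, adjoint_comp, adjoint_adjoint, comp_assoc]
  have hU₁ := one_add_conj_comp_one_add_conj (adjoint Ainv) Ainv C
    (add_add_mul_mul_eq_zero hB₁ hA₁ ((add_comm _ _).trans hACC))
  have hU₂ := one_add_conj_comp_one_add_conj Ainv (adjoint Ainv) C
    (add_add_mul_mul_eq_zero hA₂ hB₂ hACC)
  rw [adjoint_comp, hadj]
  generalize 1 + C ∘L Ainv ∘L adjoint C = U at *
  generalize 1 + C ∘L adjoint Ainv ∘L adjoint C = V at *
  simp only [← mul_def] at hU₁ hU₂ hS₁ hS₂ ⊢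
  constructor
  · rw [mul_assoc, ← mul_assoc V, hU₁, one_mul, hS₁]
  · rw [mul_assoc, ← mul_assoc S, hS₂, one_mul, hU₂]
end

section
/- Let 𝔥, K, M be complex Hilbert spaces and let A : M → M (invertible with bounded inverse), C : M → K, G : 𝔥 → K, Z : 𝔥 → M, X : M → 𝔥, R : 𝔥 → 𝔥 be bounded operators satisfying the identities A + A* = −C*C, X + Z* = −G*C, and R + R* = −G*G. Define L̂ := G − C A⁻¹ Z and K̂ := R − X A⁻¹ Z. Then K̂ + K̂* + L̂* L̂ = 0. -/
open ContinuousLinearMap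

/-- Under the identities `A + A* = −C*C`, `X + Z* = −G*C`,
`R + R* = −G*G`, the limit coefficients `L̂ = G − C A⁻¹ Z`, `K̂ = R − X A⁻¹ Z`
satisfy `K̂ + K̂* + L̂* L̂ = 0`. -/
theorem hatK_dissipation {𝔥 K M : Type*}
    [NormedAddCommGroup 𝔥] [InnerProductSpace ℂ 𝔥] [CompleteSpace 𝔥]
    [NormedAddCommGroup K] [InnerProductSpace ℂ K] [CompleteSpace K]
    [NormedAddCommGroup M] [InnerProductSpace ℂ M] [CompleteSpace M]
    (A Ainv : M →L[ℂ] M) (hA₁ : A ∘L Ainv = 1) (hA₂ : Ainv ∘L A = 1)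
    (C : M →L[ℂ] K) (G : 𝔥 →L[ℂ] K) (Z : 𝔥 →L[ℂ] M) (X : M →L[ℂ] 𝔥)
    (R : 𝔥 →L[ℂ] 𝔥)
    (hACC : A + adjoint A = -(adjoint C ∘L C))
    (hXZ : X + adjoint Z = -(adjoint G ∘L C))
    (hRR : R + adjoint R = -(adjoint G ∘L G)) :
    (R - X ∘L Ainv ∘L Z) + adjoint (R - X ∘L Ainv ∘L Z)
      + adjoint (G - C ∘L Ainv ∘L Z) ∘L (G - C ∘L Ainv ∘L Z) = 0 := by
  obtain ⟨W, hW⟩ : ∃ W, W = Ainv ∘L Z := ⟨_, rfl⟩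
  have hZ : Z = A ∘L W := by
    rw [hW, ← comp_assoc, hA₁]
    rfl
  rw [← hW]
  have hXZ' : adjoint X + Z = -(adjoint C ∘L G) := by
    simpa [adjoint_comp] using congrArg adjoint hXZ
  have hGG : adjoint G ∘L G = -R - adjoint R := by
    rw [← neg_eq_iff_eq_neg.mpr hRR]
    abel
  have hGC : adjoint G ∘L C = -X - adjoint W ∘L adjoint A := by
    rw [← adjoint_comp, ← hZ, ← neg_eq_iff_eq_neg.mpr hXZ]
    abel
  have hCG : adjoint C ∘L G = -adjoint X - A ∘L W := by
    rw [← hZ, ← neg_eq_iff_eq_neg.mpr hXZ']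
    abel
  have hCC : adjoint C ∘L C = -A - adjoint A := by
    rw [← neg_eq_iff_eq_neg.mpr hACC]
    abel
  have hL : adjoint (G - C ∘L W) ∘L (G - C ∘L W) =
      adjoint G ∘L G - (adjoint G ∘L C) ∘L W - adjoint W ∘L (adjoint C ∘L G)
        + adjoint W ∘L (adjoint C ∘L C) ∘L W := by
    simp only [map_sub, adjoint_comp, sub_comp, comp_sub, comp_assoc]
    abel
  rw [hL, hGG, hGC, hCG, hCC, map_sub, adjoint_comp]
  simp only [sub_comp, comp_sub, neg_comp, comp_neg, comp_assoc]
  abel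
end

section
/- Let K, M₁, M₂ be complex Hilbert spaces, S₁, S₂ : K → K unitary operators, A₁ : M₁ → M₁ and A₂ : M₂ → M₂ bounded operators with bounded inverses, and C₁ : M₁ → K, C₂ : M₂ → K bounded operators. Let T : M₁ ⊕ M₂ → M₁ ⊕ M₂ be the block operator [[A₁, 0],[−C₂* S₂ C₁, A₂]]. Then T is invertible and (I + [S₂C₁ C₂] ∘ T⁻¹ ∘ [C₁*S₂*; C₂*]) S₂ S₁ = (I + C₂ A₂⁻¹ C₂*) S₂ (I + C₁ A₁⁻¹ C₁*) S₁, where [S₂C₁ C₂] : M₁ ⊕ M₂ → K is the row map (x,y) ↦ S₂C₁x + C₂y and [C₁*S₂*; C₂*] : K → M₁ ⊕ M₂ is the column map u ↦ (C₁*S₂*u, C₂*u). -/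
open ContinuousLinearMap

/-- For unitaries `S₁, S₂`, invertible `A₁, A₂` and bounded
`C₁, C₂`, the block operator `T = [[A₁, 0], [−C₂*S₂C₁, A₂]]` is invertible and
`(I + [S₂C₁ C₂] T⁻¹ [C₁*S₂*; C₂*]) S₂ S₁ = (I + C₂A₂⁻¹C₂*) S₂ (I + C₁A₁⁻¹C₁*) S₁`. -/
theorem series_scattering_commute {K M₁ M₂ : Type*}
    [NormedAddCommGroup K] [InnerProductSpace ℂ K] [CompleteSpace K]
    [NormedAddCommGroup M₁] [InnerProductSpace ℂ M₁] [CompleteSpace M₁]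
    [NormedAddCommGroup M₂] [InnerProductSpace ℂ M₂] [CompleteSpace M₂]
    (S₁ S₂ : K →L[ℂ] K)
    (hS₁ : adjoint S₁ ∘L S₁ = 1) (hS₁' : S₁ ∘L adjoint S₁ = 1)
    (hS₂ : adjoint S₂ ∘L S₂ = 1) (hS₂' : S₂ ∘L adjoint S₂ = 1)
    (A₁ A₁inv : M₁ →L[ℂ] M₁) (hA₁ : A₁ ∘L A₁inv = 1) (hA₁' : A₁inv ∘L A₁ = 1)
    (A₂ A₂inv : M₂ →L[ℂ] M₂) (hA₂ : A₂ ∘L A₂inv = 1) (hA₂' : A₂inv ∘L A₂ = 1)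
    (C₁ : M₁ →L[ℂ] K) (C₂ : M₂ →L[ℂ] K) :
    ∃ Tinv : (M₁ × M₂) →L[ℂ] (M₁ × M₂),
      (A₁.coprod 0).prod ((-(adjoint C₂ ∘L S₂ ∘L C₁)).coprod A₂) ∘L Tinv = 1 ∧
      Tinv ∘L (A₁.coprod 0).prod ((-(adjoint C₂ ∘L S₂ ∘L C₁)).coprod A₂) = 1 ∧
      (1 + ((S₂ ∘L C₁).coprod C₂) ∘L Tinv ∘L
          ((adjoint C₁ ∘L adjoint S₂).prod (adjoint C₂))) ∘L S₂ ∘L S₁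
        = (1 + C₂ ∘L A₂inv ∘L adjoint C₂) ∘L S₂ ∘L
            (1 + C₁ ∘L A₁inv ∘L adjoint C₁) ∘L S₁ := by
  have e₁ x : A₁ (A₁inv x) = x := DFunLike.congr_fun hA₁ x
  have e₁' x : A₁inv (A₁ x) = x := DFunLike.congr_fun hA₁' x
  have e₂ x : A₂ (A₂inv x) = x := DFunLike.congr_fun hA₂ x
  have e₂' x : A₂inv (A₂ x) = x := DFunLike.congr_fun hA₂' x
  have hS x : adjoint S₂ (S₂ x) = x := DFunLike.congr_fun hS₂ x
  refine ⟨(A₁inv.coprod 0).prod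
    ((A₂inv ∘L adjoint C₂ ∘L S₂ ∘L C₁ ∘L A₁inv).coprod A₂inv), ?_, ?_, ?_⟩
  · refine ContinuousLinearMap.ext fun x => Prod.ext ?_ ?_ <;> simp [e₁, e₂]
  · refine ContinuousLinearMap.ext fun x => Prod.ext ?_ ?_ <;> simp [e₁', e₂']
  · refine ContinuousLinearMap.ext fun x => ?_
    simp only [comp_apply, add_apply, one_apply_eq_self, coprod_apply, prod_apply,
      zero_apply, map_add, add_zero, hS]
    abel
end

section
/- Let 𝔥, K, M₁, M₂ be complex Hilbert spaces, S₂ : K → K a bounded operator, A₁ : M₁ → M₁ and A₂ : M₂ → M₂ bounded operators with bounded inverses, C₁ : M₁ → K, C₂ : M₂ → K, G₁, G₂ : 𝔥 → K, Z₁ : 𝔥 → M₁, Z₂ : 𝔥 → M₂ bounded operators. Let T : M₁ ⊕ M₂ → M₁ ⊕ M₂ be the block operator [[A₁, 0],[−C₂* S₂ C₁, A₂]] (which is invertible). Then (G₂ + S₂G₁) − [S₂C₁ C₂] ∘ T⁻¹ ∘ (Z₁, Z₂ − C₂*S₂G₁) = (G₂ − C₂A₂⁻¹Z₂) + (I + C₂A₂⁻¹C₂*)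 S₂ (G₁ − C₁A₁⁻¹Z₁), where [S₂C₁ C₂] : M₁ ⊕ M₂ → K is the row map (x,y) ↦ S₂C₁x + C₂y and (Z₁, Z₂ − C₂*S₂G₁) : 𝔥 → M₁ ⊕ M₂ is the column map v ↦ (Z₁v, Z₂v − C₂*S₂G₁v). -/
open ContinuousLinearMap

/-- The left inverse of an invertible lower triangular block operator, by forward substitution. -/
theorem lower_triangular_left_inverse_apply {M₁ M₂ : Type*}
    [NormedAddCommGroup M₁] [NormedSpace ℂ M₁] [NormedAddCommGroup M₂] [NormedSpace ℂ M₂]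
    {A₁ A₁inv : M₁ →L[ℂ] M₁} (hA₁ : A₁ ∘L A₁inv = 1)
    {A₂ A₂inv : M₂ →L[ℂ] M₂} (hA₂ : A₂ ∘L A₂inv = 1) {B : M₁ →L[ℂ] M₂}
    {Tinv : (M₁ × M₂) →L[ℂ] (M₁ × M₂)}
    (hT : Tinv ∘L (A₁.coprod 0).prod (B.coprod A₂) = 1) (x : M₁) (y : M₂) :
    Tinv (x, y) = (A₁inv x, A₂inv (y - B (A₁inv x))) := by
  have h₁ (u : M₁) : A₁ (A₁inv u) = u := DFunLike.congr_fun hA₁ u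
  have h₂ (u : M₂) : A₂ (A₂inv u) = u := DFunLike.congr_fun hA₂ u
  simpa [h₁, h₂] using DFunLike.congr_fun hT (A₁inv x, A₂inv (y - B (A₁inv x)))

/-- With `T = [[A₁, 0], [−C₂*S₂C₁, A₂]]` (invertible, with
inverse `Tinv`), the coupling operator of the series connection after adiabatic
elimination satisfies
`(G₂ + S₂G₁) − [S₂C₁ C₂] T⁻¹ (Z₁, Z₂ − C₂*S₂G₁)
  = (G₂ − C₂A₂⁻¹Z₂) + (I + C₂A₂⁻¹C₂*) S₂ (G₁ − C₁A₁⁻¹Z₁)`. -/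
theorem series_coupling_commute {𝔥 K M₁ M₂ : Type*}
    [NormedAddCommGroup 𝔥] [InnerProductSpace ℂ 𝔥] [CompleteSpace 𝔥]
    [NormedAddCommGroup K] [InnerProductSpace ℂ K] [CompleteSpace K]
    [NormedAddCommGroup M₁] [InnerProductSpace ℂ M₁] [CompleteSpace M₁]
    [NormedAddCommGroup M₂] [InnerProductSpace ℂ M₂] [CompleteSpace M₂]
    (S₂ : K →L[ℂ] K)
    (A₁ A₁inv : M₁ →L[ℂ] M₁) (hA₁ : A₁ ∘L A₁inv = 1) (hA₁' : A₁inv ∘L A₁ = 1)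
    (A₂ A₂inv : M₂ →L[ℂ] M₂) (hA₂ : A₂ ∘L A₂inv = 1) (hA₂' : A₂inv ∘L A₂ = 1)
    (C₁ : M₁ →L[ℂ] K) (C₂ : M₂ →L[ℂ] K) (G₁ G₂ : 𝔥 →L[ℂ] K)
    (Z₁ : 𝔥 →L[ℂ] M₁) (Z₂ : 𝔥 →L[ℂ] M₂)
    (Tinv : (M₁ × M₂) →L[ℂ] (M₁ × M₂))
    (hT : (A₁.coprod 0).prod ((-(adjoint C₂ ∘L S₂ ∘L C₁)).coprod A₂) ∘L Tinv = 1)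
    (hT' : Tinv ∘L (A₁.coprod 0).prod ((-(adjoint C₂ ∘L S₂ ∘L C₁)).coprod A₂) = 1) :
    (G₂ + S₂ ∘L G₁) - ((S₂ ∘L C₁).coprod C₂) ∘L Tinv ∘L
        (Z₁.prod (Z₂ - adjoint C₂ ∘L S₂ ∘L G₁))
      = (G₂ - C₂ ∘L A₂inv ∘L Z₂)
        + (1 + C₂ ∘L A₂inv ∘L adjoint C₂) ∘L S₂ ∘L (G₁ - C₁ ∘L A₁inv ∘L Z₁) := by
  ext v
  simp only [add_apply, sub_apply, comp_apply, prod_apply, coprod_apply, neg_apply, one_apply_eq_self,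
    lower_triangular_left_inverse_apply hA₁ hA₂ hT', map_sub, map_neg]
  abel
end

section
/- Let 𝔥, K, M₁, M₂ be complex Hilbert spaces, S₂ : K → K a bounded operator, A₁ : M₁ → M₁ and A₂ : M₂ → M₂ bounded operators with bounded inverses, C₁ : M₁ → K, C₂ : M₂ → K, G₁, G₂ : 𝔥 → K, Z₁ : 𝔥 → M₁, Z₂ : 𝔥 → M₂, X₁ : M₁ → 𝔥, X₂ : M₂ → 𝔥, R₁, R₂ : 𝔥 → 𝔥 bounded operators satisfying A₂ + A₂* = −C₂*C₂ and X₂ + Z₂* = −G₂*C₂. Let T : M₁ ⊕ M₂ → M₁ ⊕ M₂ be the block operator [[A₁, 0],[−C₂* S₂ C₁, A₂]] (which is invertible). Then (R₁ + R₂ − G₂*S₂G₁) − [X₁ − G₂*S₂C₁, X₂] ∘ T⁻¹ ∘ (Z₁, Z₂ − C₂*S₂G₁) = (R₁ − X₁A₁⁻¹Z₁) + (R₂ − X₂A₂⁻¹Z₂) − (G₂ − C₂A₂⁻¹Z₂)* (I + C₂A₂⁻¹C₂*) S₂ (G₁ − C₁A₁⁻¹Z₁), where [X₁ − G₂*S₂C₁,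 X₂] : M₁ ⊕ M₂ → 𝔥 is the row map (x,y) ↦ (X₁ − G₂*S₂C₁)x + X₂y and (Z₁, Z₂ − C₂*S₂G₁) : 𝔥 → M₁ ⊕ M₂ is the column map v ↦ (Z₁v, Z₂v − C₂*S₂G₁v). -/
open ContinuousLinearMap

/-- The identity `(G − C A⁻¹ Z)* (I + C A⁻¹ C*) = G* − X A⁻¹ C*`, for `A + A* = −C*C` and
`X + Z* = −G*C`. -/
theorem adjoint_comp_one_add_comp_eq {H K M : Type*}
    [NormedAddCommGroup H] [InnerProductSpace ℂ H] [CompleteSpace H]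
    [NormedAddCommGroup K] [InnerProductSpace ℂ K] [CompleteSpace K]
    [NormedAddCommGroup M] [InnerProductSpace ℂ M] [CompleteSpace M]
    {A Ainv : M →L[ℂ] M} (hA : A ∘L Ainv = 1)
    {C : M →L[ℂ] K} {G : H →L[ℂ] K} {Z : H →L[ℂ] M} {X : M →L[ℂ] H}
    (hAC : A + adjoint A = -(adjoint C ∘L C))
    (hXZ : X + adjoint Z = -(adjoint G ∘L C)) :
    adjoint (G - C ∘L Ainv ∘L Z) ∘L (1 + C ∘L Ainv ∘L adjoint C)
      = adjoint G - X ∘L Ainv ∘L adjoint C := by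
  have hadj (m : M) : adjoint Ainv (adjoint A m) = m := by
    have h := congrArg adjoint hA
    rw [adjoint_comp, one_def, adjoint_id] at h
    exact DFunLike.congr_fun h m
  have hinv (m : M) : A (Ainv m) = m := DFunLike.congr_fun hA m
  have hCC (m : M) : adjoint C (C m) = -(A m + adjoint A m) := by
    have h := DFunLike.congr_fun hAC m
    simp only [add_apply, neg_apply, comp_apply] at h
    rw [h, neg_neg]
  have hGC (m : M) : adjoint G (C m) = -(X m + adjoint Z m) := by
    have h := DFunLike.congr_fun hXZ m
    simp only [add_apply, neg_apply, comp_apply] at h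
    rw [h, neg_neg]
  ext k
  simp only [map_sub, adjoint_comp, comp_apply, sub_apply, add_apply, one_def, id_apply, map_add,
    hCC, hGC, hinv, hadj, map_neg]
  abel

/-- With `T = [[A₁, 0], [−C₂*S₂C₁, A₂]]` (invertible, with
inverse `Tinv`), and the identities `A₂ + A₂* = −C₂*C₂`, `X₂ + Z₂* = −G₂*C₂`,
the damping operator of the series connection after adiabatic elimination
satisfies
`(R₁ + R₂ − G₂*S₂G₁) − [X₁ − G₂*S₂C₁, X₂] T⁻¹ (Z₁, Z₂ − C₂*S₂G₁)
  = (R₁ − X₁A₁⁻¹Z₁) + (R₂ − X₂A₂⁻¹Z₂)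
    − (G₂ − C₂A₂⁻¹Z₂)* (I + C₂A₂⁻¹C₂*) S₂ (G₁ − C₁A₁⁻¹Z₁)`. -/
theorem series_damping_commute {𝔥 K M₁ M₂ : Type*}
    [NormedAddCommGroup 𝔥] [InnerProductSpace ℂ 𝔥] [CompleteSpace 𝔥]
    [NormedAddCommGroup K] [InnerProductSpace ℂ K] [CompleteSpace K]
    [NormedAddCommGroup M₁] [InnerProductSpace ℂ M₁] [CompleteSpace M₁]
    [NormedAddCommGroup M₂] [InnerProductSpace ℂ M₂] [CompleteSpace M₂]
    (S₂ : K →L[ℂ] K)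
    (A₁ A₁inv : M₁ →L[ℂ] M₁) (hA₁ : A₁ ∘L A₁inv = 1) (hA₁' : A₁inv ∘L A₁ = 1)
    (A₂ A₂inv : M₂ →L[ℂ] M₂) (hA₂ : A₂ ∘L A₂inv = 1) (hA₂' : A₂inv ∘L A₂ = 1)
    (C₁ : M₁ →L[ℂ] K) (C₂ : M₂ →L[ℂ] K) (G₁ G₂ : 𝔥 →L[ℂ] K)
    (Z₁ : 𝔥 →L[ℂ] M₁) (Z₂ : 𝔥 →L[ℂ] M₂)
    (X₁ : M₁ →L[ℂ] 𝔥) (X₂ : M₂ →L[ℂ] 𝔥) (R₁ R₂ : 𝔥 →L[ℂ] 𝔥)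
    (hACC : A₂ + adjoint A₂ = -(adjoint C₂ ∘L C₂))
    (hXZ : X₂ + adjoint Z₂ = -(adjoint G₂ ∘L C₂))
    (Tinv : (M₁ × M₂) →L[ℂ] (M₁ × M₂))
    (hT : (A₁.coprod 0).prod ((-(adjoint C₂ ∘L S₂ ∘L C₁)).coprod A₂) ∘L Tinv = 1)
    (hT' : Tinv ∘L (A₁.coprod 0).prod ((-(adjoint C₂ ∘L S₂ ∘L C₁)).coprod A₂) = 1) :
    (R₁ + R₂ - adjoint G₂ ∘L S₂ ∘L G₁)
        - ((X₁ - adjoint G₂ ∘L S₂ ∘L C₁).coprod X₂) ∘L Tinv ∘L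
            (Z₁.prod (Z₂ - adjoint C₂ ∘L S₂ ∘L G₁))
      = (R₁ - X₁ ∘L A₁inv ∘L Z₁) + (R₂ - X₂ ∘L A₂inv ∘L Z₂)
        - adjoint (G₂ - C₂ ∘L A₂inv ∘L Z₂) ∘L
            (1 + C₂ ∘L A₂inv ∘L adjoint C₂) ∘L S₂ ∘L (G₁ - C₁ ∘L A₁inv ∘L Z₁) := by
  have hinv₁ (m : M₁) : A₁inv (A₁ m) = m := DFunLike.congr_fun hA₁' m
  have hinv₂ (m : M₂) : A₂inv (A₂ m) = m := DFunLike.congr_fun hA₂' m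
  rw [← comp_assoc (adjoint (G₂ - C₂ ∘L A₂inv ∘L Z₂)), adjoint_comp_one_add_comp_eq hA₂ hACC hXZ]
  ext v
  have h := DFunLike.congr_fun hT (Z₁ v, Z₂ v - adjoint C₂ (S₂ (G₁ v)))
  simp only [comp_apply, prod_apply, coprod_apply, one_def, id_apply, zero_apply, add_zero,
    neg_apply, Prod.mk.injEq] at h
  simp only [comp_apply, prod_apply, coprod_apply, sub_apply, add_apply]
  obtain ⟨h₁, h₂⟩ := h
  generalize Tinv (Z₁ v, Z₂ v - adjoint C₂ (S₂ (G₁ v))) = y at h₁ h₂ ⊢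
  have hy₁ : y.1 = A₁inv (Z₁ v) := by rw [← h₁, hinv₁]
  have hy₂ : y.2 = A₂inv (Z₂ v - adjoint C₂ (S₂ (G₁ v)) + adjoint C₂ (S₂ (C₁ y.1))) := by
    rw [← h₂, neg_add_cancel_comm, hinv₂]
  rw [hy₂, hy₁]
  simp only [map_sub, map_add]
  abel
end

section
/- (Commutativity of adiabatic elimination and the instantaneous feedback limit.) Let H₁, H₂, H₃, 𝒦 be complex Hilbert spaces and let R₁ : H₁ → H₁, M₁ : H₂ → H₁, X₁ : H₃ → H₁, G₁ : H₁ → H₂, S_ii : H₂ → H₂, C_i : H₃ → H₂, Z₁ : H₁ → H₃, S_i : H₂ → 𝒦, C : H₃ → 𝒦 be bounded operators. Write Σ := S_ii − I. Suppose A : H₃ → H₃ is a bounded operator with bounded inverse, Σ is invertible, and Σ + C_i A⁻¹ C* S_i is invertible. Then A + C* S_i Σ⁻¹ C_i is invertible, and the two iterated Schur complements of the 3×3 block operator [[R₁, M₁, X₁],[G₁, Σ, C_i],[Z₁, −C*S_i, A]] agree: (R₁ − X₁A⁻¹Z₁) − (M₁ + X₁A⁻¹C*S_i)(Σ + C_iA⁻¹C*S_i)⁻¹(G₁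 − C_iA⁻¹Z₁) = (R₁ − M₁Σ⁻¹G₁) − (X₁ − M₁Σ⁻¹C_i)(A + C*S_iΣ⁻¹C_i)⁻¹(Z₁ + C*S_iΣ⁻¹G₁). (The left side is the instantaneous feedback reduction applied after adiabatic elimination of the fast block A; the right side is adiabatic elimination applied after the instantaneous feedback reduction of the internal block Σ.) -/
open ContinuousLinearMap

/-- **commutativity of adiabatic elimination and the
instantaneous feedback limit.** For the 3×3 block operator
`[[R₁, M₁, X₁], [G₁, Σ, C_i], [Z₁, −C*S_i, A]]` with `Σ = S_ii − I`, if `A` is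
invertible, `Σ` is invertible, and `Σ + C_i A⁻¹ C* S_i` is invertible, then
`A + C* S_i Σ⁻¹ C_i` is invertible and the two iterated Schur complements
agree. -/
theorem adiabatic_feedback_commute {H₁ H₂ H₃ 𝓚 : Type*}
    [NormedAddCommGroup H₁] [InnerProductSpace ℂ H₁] [CompleteSpace H₁]
    [NormedAddCommGroup H₂] [InnerProductSpace ℂ H₂] [CompleteSpace H₂]
    [NormedAddCommGroup H₃] [InnerProductSpace ℂ H₃] [CompleteSpace H₃]
    [NormedAddCommGroup 𝓚] [InnerProductSpace ℂ 𝓚] [CompleteSpace 𝓚]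
    (R₁ : H₁ →L[ℂ] H₁) (M₁ : H₂ →L[ℂ] H₁) (X₁ : H₃ →L[ℂ] H₁)
    (G₁ : H₁ →L[ℂ] H₂) (Sii : H₂ →L[ℂ] H₂) (Ci : H₃ →L[ℂ] H₂)
    (Z₁ : H₁ →L[ℂ] H₃) (Si : H₂ →L[ℂ] 𝓚) (C : H₃ →L[ℂ] 𝓚)
    (A Ainv : H₃ →L[ℂ] H₃) (hA : A ∘L Ainv = 1) (hA' : Ainv ∘L A = 1)
    (Sigmainv : H₂ →L[ℂ] H₂)
    (hSigma : (Sii - 1) ∘L Sigmainv = 1) (hSigma' : Sigmainv ∘L (Sii - 1) = 1)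
    (Einv : H₂ →L[ℂ] H₂)
    (hE : (Sii - 1 + Ci ∘L Ainv ∘L adjoint C ∘L Si) ∘L Einv = 1)
    (hE' : Einv ∘L (Sii - 1 + Ci ∘L Ainv ∘L adjoint C ∘L Si) = 1) :
    ∃ Winv : H₃ →L[ℂ] H₃,
      (A + adjoint C ∘L Si ∘L Sigmainv ∘L Ci) ∘L Winv = 1 ∧
      Winv ∘L (A + adjoint C ∘L Si ∘L Sigmainv ∘L Ci) = 1 ∧
      (R₁ - X₁ ∘L Ainv ∘L Z₁)
          - (M₁ + X₁ ∘L Ainv ∘L adjoint C ∘L Si) ∘L Einv ∘L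
              (G₁ - Ci ∘L Ainv ∘L Z₁)
        = (R₁ - M₁ ∘L Sigmainv ∘L G₁)
          - (X₁ - M₁ ∘L Sigmainv ∘L Ci) ∘L Winv ∘L
              (Z₁ + adjoint C ∘L Si ∘L Sigmainv ∘L G₁) := by
  have hA₁ (x : H₃) : A (Ainv x) = x := DFunLike.congr_fun hA x
  have hA₂ (x : H₃) : Ainv (A x) = x := DFunLike.congr_fun hA' x
  have right_resolvent (x : H₂) :
      Sigmainv (Ci (Ainv (adjoint C (Si (Einv x))))) = Sigmainv x - Einv x := by
    have h := congrArg Sigmainv (DFunLike.congr_fun hE x)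
    have h' := DFunLike.congr_fun hSigma' (Einv x)
    simp only [comp_apply, add_apply, sub_apply, one_apply_eq_self, map_add, map_sub] at h h'
    rw [h'] at h
    exact eq_sub_of_add_eq' h
  have left_resolvent (x : H₂) :
      Einv (Ci (Ainv (adjoint C (Si (Sigmainv x))))) = Sigmainv x - Einv x := by
    have h := DFunLike.congr_fun hE' (Sigmainv x)
    have h' := congrArg Einv (DFunLike.congr_fun hSigma x)
    simp only [comp_apply, add_apply, sub_apply, one_apply_eq_self, map_add, map_sub] at h h'
    rw [h'] at h
    exact eq_sub_of_add_eq' h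
  refine ⟨Ainv - Ainv ∘L adjoint C ∘L Si ∘L Einv ∘L Ci ∘L Ainv, ?_, ?_, ?_⟩ <;>
  · ext x
    simp only [comp_apply, add_apply, sub_apply, one_apply_eq_self, map_add, map_sub, hA₁, hA₂,
      right_resolvent, left_resolvent]
    abel
end
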